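/- arXiv:0812.0651 — 5 statements merged into one kernel-verified Lean document; each statement's English description precedes it below -/
import Mathlib

section
/- A Hermitian 2×2 complex matrix w satisfies det w = 0 if and only if there exists a vector u : Fin 2 → ℂ with w = vecMulVec u (star u) or w = −vecMulVec u (star u). (Thus the null cone in the Hermitian (Minkowski) space splits into the future cone {u ⊗ ū} and the past cone {−u ⊗ ū}.) -/
open Matrix

/-- A singular Hermitian 2×2 matrix with nonnegative diagonal has the form `u ⊗ ū`. -/
theorem Matrix.IsHermitian.exists_eq_vecMulVec_star_of_det_eq_zero
    {w : Matrix (Fin 2) (Fin 2) ℂ} (hw : w.IsHermitian) (hdet : w.det = 0)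
    (h₀ : 0 ≤ (w 0 0).re) (h₁ : 0 ≤ (w 1 1).re) :
    ∃ u : Fin 2 → ℂ, w = vecMulVec u (star u) := by
  obtain ⟨a, ha⟩ : ∃ a : ℝ, w 0 0 = a := ⟨_, (hw.coe_re_apply_self 0).symm⟩
  obtain ⟨d, hd⟩ : ∃ d : ℝ, w 1 1 = d := ⟨_, (hw.coe_re_apply_self 1).symm⟩
  have hb : w 1 0 = star (w 0 1) := (hw.apply 1 0).symm
  rw [ha, Complex.ofReal_re] at h₀
  rw [hd, Complex.ofReal_re] at h₁
  rw [det_fin_two, ha, hd, hb, sub_eq_zero] at hdet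
  rcases h₀.eq_or_lt with rfl | hpos
  · have hb₀ : w 0 1 = 0 := by simpa using hdet
    have hs : ((√d : ℝ) : ℂ) * (√d : ℝ) = d := by
      rw [← Complex.ofReal_mul, Real.mul_self_sqrt h₁]
    refine ⟨![0, (√d : ℝ)], ?_⟩
    ext i j
    fin_cases i <;> fin_cases j <;> simp [vecMulVec_apply, ha, hd, hb, hb₀, hs]
  · have hs : ((√a : ℝ) : ℂ) * (√a : ℝ) = a := by
      rw [← Complex.ofReal_mul, Real.mul_self_sqrt h₀]
    have hs₀ : ((√a : ℝ) : ℂ) ≠ 0 := Complex.ofReal_ne_zero.2 (Real.sqrt_pos.2 hpos).ne'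
    have hdb : (d : ℂ) = star (w 0 1) / (√a : ℝ) * (w 0 1 / (√a : ℝ)) := by
      rw [div_mul_div_comm, hs, eq_div_iff (Complex.ofReal_ne_zero.2 hpos.ne'), mul_comm, hdet,
        mul_comm]
    refine ⟨![(√a : ℝ), star (w 0 1) / (√a : ℝ)], ?_⟩
    ext i j
    fin_cases i <;> fin_cases j
    · simp [vecMulVec_apply, ha, hs]
    · simp [vecMulVec_apply, mul_div_cancel₀, hs₀]
    · simp [vecMulVec_apply, hb, hs₀]
    · simpa [vecMulVec_apply, hd] using hdb

/-- The diagonal entries of a singular Hermitian 2×2 matrix do not have opposite signs. -/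
theorem Matrix.IsHermitian.re_mul_re_nonneg_of_det_eq_zero
    {w : Matrix (Fin 2) (Fin 2) ℂ} (hw : w.IsHermitian) (hdet : w.det = 0) :
    0 ≤ (w 0 0).re * (w 1 1).re := by
  have hb : w 1 0 = star (w 0 1) := (hw.apply 1 0).symm
  rw [det_fin_two, hb, sub_eq_zero, ← hw.coe_re_apply_self 0, ← hw.coe_re_apply_self 1] at hdet
  have h : (w 0 0).re * (w 1 1).re = Complex.normSq (w 0 1) := by
    apply Complex.ofReal_injective
    simpa [Complex.mul_conj] using hdet
  exact h ▸ Complex.normSq_nonneg _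

/-- A Hermitian 2×2 complex matrix `w` has `det w = 0` iff it lies on the
null cone: `w = u ⊗ ū` (future cone) or `w = −u ⊗ ū` (past cone) for some
vector `u : Fin 2 → ℂ`. -/
theorem hermitian_det_eq_zero_iff_null_cone (w : Matrix (Fin 2) (Fin 2) ℂ)
    (hw : w.IsHermitian) :
    w.det = 0 ↔ ∃ u : Fin 2 → ℂ,
      w = vecMulVec u (star u) ∨ w = -vecMulVec u (star u) := by
  constructor
  · intro hdet
    rcases mul_nonneg_iff.1 (hw.re_mul_re_nonneg_of_det_eq_zero hdet) with ⟨h₀, h₁⟩ | ⟨h₀, h₁⟩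
    · obtain ⟨u, hu⟩ := hw.exists_eq_vecMulVec_star_of_det_eq_zero hdet h₀ h₁
      exact ⟨u, Or.inl hu⟩
    · obtain ⟨u, hu⟩ := hw.neg.exists_eq_vecMulVec_star_of_det_eq_zero
        (by simp [det_neg, hdet]) (by simpa using h₀) (by simpa using h₁)
      exact ⟨u, Or.inr (neg_eq_iff_eq_neg.1 hu)⟩
  · rintro ⟨u, rfl | rfl⟩ <;> simp [det_neg, det_vecMulVec]
end

section
/- Let K be a 2×2 complex matrix with det K = 1 (an element of SL(2,ℂ)). Then the map A ↦ K * A * Kᴴ preserves the Hermitian subspace and the Lorentz metric: (i) if A is Hermitian then K * A * Kᴴ is Hermitian; (ii) for all 2×2 complex matrices A, B, det(K*A*Kᴴ + K*B*Kᴴ) − det(K*A*Kᴴ) − det(K*B*Kᴴ) = det(A+B) − det A − det B; and (iii) for every u : Fin 2 → ℂ, K * vecMulVec u (star u) * Kᴴ = vecMulVec (K.mulVec u) (star (K.mulVec u)), so the future null cone {u ⊗ ū} is preserved. -/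
open Matrix

/-- Every K ∈ SL(2,ℂ) acts on 2×2 complex matrices by A ↦ K A Kᴴ, preserving:
(i) the Hermitian subspace, (ii) the Lorentz metric
g(A,B) = det(A+B) − det A − det B, (iii) the future null cone {u ⊗ ū}. -/
theorem sl2_action_preserves_minkowski (K : Matrix (Fin 2) (Fin 2) ℂ)
    (hK : K.det = 1) :
    (∀ A : Matrix (Fin 2) (Fin 2) ℂ, A.IsHermitian → (K * A * Kᴴ).IsHermitian) ∧
    (∀ A B : Matrix (Fin 2) (Fin 2) ℂ,
      (K * A * Kᴴ + K * B * Kᴴ).det - (K * A * Kᴴ).det - (K * B * Kᴴ).det =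
        (A + B).det - A.det - B.det) ∧
    (∀ u : Fin 2 → ℂ,
      K * vecMulVec u (star u) * Kᴴ =
        vecMulVec (K.mulVec u) (star (K.mulVec u))) := by
  have det_conj (A : Matrix (Fin 2) (Fin 2) ℂ) : (K * A * Kᴴ).det = A.det := by
    simp [det_mul, det_conjTranspose, hK]
  refine ⟨fun A hA => isHermitian_mul_mul_conjTranspose K hA, fun A B => ?_, fun u => ?_⟩
  · rw [← Matrix.add_mul, ← Matrix.mul_add, det_conj, det_conj, det_conj]
  · rw [mul_vecMulVec, vecMulVec_mul, star_mulVec]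
end

section
/- Let K be a 2×2 complex matrix with det K = 1. Then K * A * Kᴴ = A holds for every Hermitian 2×2 complex matrix A if and only if K = 1 or K = −1. (The kernel of the covering homomorphism SL(2,ℂ) → Lorentz group is {±1}.) -/
open Matrix

/-- A matrix acting trivially on Hermitian matrices by `A ↦ K * A * Kᴴ` commutes with each of
them. -/
lemma commute_of_forall_isHermitian_mul_mul_conjTranspose_eq {n R : Type*} [Fintype n]
    [DecidableEq n] [CommRing R] [StarRing R] {K : Matrix n n R}
    (h : ∀ A : Matrix n n R, A.IsHermitian → K * A * Kᴴ = A)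
    {A : Matrix n n R} (hA : A.IsHermitian) : Commute K A := by
  have hunit : Kᴴ * K = 1 :=
    mul_eq_one_comm.mp (by simpa using h 1 isHermitian_one)
  calc K * A = K * A * Kᴴ * K := by rw [Matrix.mul_assoc (K * A), hunit, Matrix.mul_one]
    _ = A * K := by rw [h A hA]

/-- The kernel of the covering SL(2,ℂ) → Lorentz group is {±1}:
for K with det K = 1, K A Kᴴ = A for every Hermitian A iff K = 1 or K = −1. -/
theorem sl2_acts_trivially_iff_pm_one (K : Matrix (Fin 2) (Fin 2) ℂ)
    (hK : K.det = 1) :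
    (∀ A : Matrix (Fin 2) (Fin 2) ℂ, A.IsHermitian → K * A * Kᴴ = A) ↔
      K = 1 ∨ K = -1 := by
  constructor
  · intro h
    have hz : Commute K !![1, 0; 0, 0] :=
      commute_of_forall_isHermitian_mul_mul_conjTranspose_eq h <| by
        ext i j; fin_cases i <;> fin_cases j <;> simp
    have hx : Commute K !![0, 1; 1, 0] :=
      commute_of_forall_isHermitian_mul_mul_conjTranspose_eq h <| by
        ext i j; fin_cases i <;> fin_cases j <;> simp
    have h01 : K 0 1 = 0 := by
      simpa [Matrix.mul_apply, Fin.sum_univ_two] using (congr_fun₂ hz.eq 0 1).symm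
    have h10 : K 1 0 = 0 := by
      simpa [Matrix.mul_apply, Fin.sum_univ_two] using congr_fun₂ hz.eq 1 0
    have h11 : K 1 1 = K 0 0 := by
      simpa [Matrix.mul_apply, Fin.sum_univ_two] using (congr_fun₂ hx.eq 0 1).symm
    have hsq : K 0 0 * K 0 0 = 1 := by simpa [det_fin_two, h01, h11] using hK
    refine (mul_self_eq_one_iff.mp hsq).imp (fun h00 ↦ ?_) fun h00 ↦ ?_ <;>
    · ext i j
      fin_cases i <;> fin_cases j <;> simp [h00, h01, h10, h11]
  · rintro (rfl | rfl) A - <;> simp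
end

section
/- For a 2×2 complex matrix θ, the following are equivalent: (i) θ * A + A * θᴴ = 0 for every Hermitian 2×2 complex matrix A; (ii) there exists a real number a such that θ = (a • Complex.I) • 1, i.e. θ is an imaginary multiple of the identity. (This is the uniqueness statement for spinor Fermi connections: two linear connections on the restricted 2-spinor bundle induce the same Fermi connection on the Minkowski bundle if and only if they differ by a term i α ⊗ 𝟙 with α a real 1-form.) -/
open Matrix

/-- A 2×2 complex matrix θ acts trivially on the Hermitian (Minkowski) space
via A ↦ θA + Aθᴴ iff θ is an imaginary multiple of the identity.
(Uniqueness of the spinor Fermi connection up to a term i α ⊗ 𝟙.) -/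
theorem infinitesimal_action_trivial_iff_imaginary_multiple_of_id
    (θ : Matrix (Fin 2) (Fin 2) ℂ) :
    (∀ A : Matrix (Fin 2) (Fin 2) ℂ, A.IsHermitian → θ * A + A * θᴴ = 0) ↔
      ∃ a : ℝ, θ = (a • Complex.I) • 1 := by
  constructor
  · intro h
    have h₁ := h !![1, 0; 0, 0] (by ext i j; fin_cases i <;> fin_cases j <;> simp)
    have h₂ := h !![0, 0; 0, 1] (by ext i j; fin_cases i <;> fin_cases j <;> simp)
    have h₃ := h !![0, 1; 1, 0] (by ext i j; fin_cases i <;> fin_cases j <;> simp)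
    have diag : θ 0 0 + star (θ 0 0) = 0 := by
      simpa [Matrix.mul_apply, Matrix.vecMul, dotProduct, Fin.sum_univ_two] using congr_fun₂ h₁ 0 0
    have lower : θ 1 0 = 0 := by
      simpa [Matrix.mul_apply, Matrix.vecMul, dotProduct, Fin.sum_univ_two] using congr_fun₂ h₁ 1 0
    have upper : θ 0 1 = 0 := by
      simpa [Matrix.mul_apply, Matrix.vecMul, dotProduct, Fin.sum_univ_two] using congr_fun₂ h₂ 0 1
    have cross : θ 1 1 + star (θ 0 0) = 0 := by
      simpa [Matrix.mul_apply, Matrix.vecMul, dotProduct, Fin.sum_univ_two] using congr_fun₂ h₃ 1 0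
    have re_zero : (θ 0 0).re = 0 := by
      have := congr_arg Complex.re diag
      simp only [Complex.star_def, Complex.add_re, Complex.conj_re, Complex.zero_re] at this
      linarith
    have imaginary : θ 0 0 = (θ 0 0).im • Complex.I := by
      apply Complex.ext <;> simp [re_zero]
    have equal : θ 1 1 = θ 0 0 := add_right_cancel (cross.trans diag.symm)
    refine ⟨(θ 0 0).im, ?_⟩
    rw [← imaginary]
    ext i j
    fin_cases i <;> fin_cases j <;> simp [lower, upper, equal]
  · rintro ⟨a, rfl⟩ A -
    simp [Matrix.conjTranspose_smul]
end

section
/- Let V be a finite-dimensional real vector space with a symmetric bilinear form B : V →ₗ[ℝ] V →ₗ[ℝ] ℝ, and let τ, X, Y : ℝ → V be differentiable curves with B (τ t) (τ t) = 1 for all t. Define the Fermi derivative of a differentiable curve Z by (D Z) t := deriv Z t + (B (deriv τ t) (Z t)) • τ t − (B (τ t) (Z t)) • deriv τ t. Then for all t: deriv (fun s => B (X s) (Y s)) t = B ((D X) t) (Y t) + B (X t) ((D Y) t). In particular, if D X = 0 and D Y = 0 then B (X t) (Y t) is constant: the scalar product of Fermi-transported vectors is constant along the world line. -/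
/-- The product rule for a bilinear form on a finite-dimensional real space. -/
theorem LinearMap.hasDerivAt_apply_apply
    {V : Type*} [NormedAddCommGroup V] [NormedSpace ℝ V] [FiniteDimensional ℝ V]
    (B : V →ₗ[ℝ] V →ₗ[ℝ] ℝ) {X Y : ℝ → V} {X' Y' : V} {t : ℝ}
    (hX : HasDerivAt X X' t) (hY : HasDerivAt Y Y' t) :
    HasDerivAt (fun s => B (X s) (Y s)) (B X' (Y t) + B (X t) Y') t := by
  have h := B.toContinuousBilinearMap.hasDerivAt_of_bilinear (fun _ => hX) (fun _ => hY)
  rw [add_comm]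
  exact h

/-- Leibniz rule for the Fermi derivative
D Z t = Z' t + B(τ' t, Z t) • τ t − B(τ t, Z t) • τ' t
along a unit curve τ (B(τ,τ) = 1) in a finite-dimensional real vector space
with a symmetric bilinear form B:
(B(X,Y))' = B(D X, Y) + B(X, D Y).  In particular the scalar product of
Fermi-transported curves is constant. -/
theorem fermi_derivative_leibniz
    {V : Type*} [NormedAddCommGroup V] [NormedSpace ℝ V] [FiniteDimensional ℝ V]
    (B : V →ₗ[ℝ] V →ₗ[ℝ] ℝ) (hB : ∀ x y : V, B x y = B y x)
    (τ X Y : ℝ → V)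
    (hτ : Differentiable ℝ τ) (hX : Differentiable ℝ X) (hY : Differentiable ℝ Y)
    (hunit : ∀ t : ℝ, B (τ t) (τ t) = 1)
    (D : (ℝ → V) → (ℝ → V))
    (hD : ∀ Z : ℝ → V, ∀ t : ℝ, D Z t =
      deriv Z t + (B (deriv τ t) (Z t)) • τ t - (B (τ t) (Z t)) • deriv τ t) :
    (∀ t : ℝ, deriv (fun s => B (X s) (Y s)) t =
      B (D X t) (Y t) + B (X t) (D Y t)) ∧
    ((∀ t : ℝ, D X t = 0) → (∀ t : ℝ, D Y t = 0) →
      ∀ t t' : ℝ, B (X t) (Y t) = B (X t') (Y t')) := by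
  have key (t : ℝ) : HasDerivAt (fun s => B (X s) (Y s)) (B (D X t) (Y t) + B (X t) (D Y t)) t := by
    convert B.hasDerivAt_apply_apply (hX t).hasDerivAt (hY t).hasDerivAt using 1
    simp only [hD, map_add, map_sub, map_smul, LinearMap.add_apply, LinearMap.sub_apply,
      LinearMap.smul_apply, smul_eq_mul, hB (X t) (τ t), hB (X t) (deriv τ t)]
    ring
  refine ⟨fun t => (key t).deriv, fun hDX hDY t t' => ?_⟩
  refine is_const_of_deriv_eq_zero (fun s => (key s).differentiableAt) (fun s => ?_) t t'
  simp [(key s).deriv, hDX s, hDY s]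
end
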